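/- arXiv:2010.09218 — 6 statements merged into one kernel-verified Lean document; each statement's English description precedes it below -/
import Mathlib

section
/- For every integer n ≥ 1 and every real φ > 0, one has (−1)^{n+1}·((φ+1)e^{−φ} − P_{n+1}(φ) − φ·P_n(φ)) > 0; in particular, for odd n, P_{n+1}(φ) + φ·P_n(φ) < (φ+1)e^{−φ} for all φ > 0. -/
open Real

/-- `P m φ = ∑_{k=0}^{m} (−1)^k φ^k/k!`, the `m`-th Taylor polynomial of `e^{−φ}` at `0`. -/
noncomputable def P (m : ℕ) (φ : ℝ) : ℝ :=
  ∑ k ∈ Finset.range (m + 1), (-1 : ℝ) ^ k * φ ^ k / (Nat.factorial k)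

theorem pos_of_hasDerivAt_pos {f f' : ℝ → ℝ} (h0 : f 0 = 0)
    (hf : ∀ x, HasDerivAt f (f' x) x) (hpos : ∀ x, 0 < x → 0 < f' x) {x : ℝ} (hx : 0 < x) :
    0 < f x := by
  have hmono : StrictMonoOn f (Set.Ici 0) := by
    apply strictMonoOn_of_deriv_pos (convex_Ici 0)
    · exact fun y _ => (hf y).continuousAt.continuousWithinAt
    · intro y hy
      rw [interior_Ici] at hy
      rw [(hf y).deriv]
      exact hpos y hy
  simpa [h0] using hmono Set.self_mem_Ici hx.le hx

theorem P_zero_right (m : ℕ) : P m 0 = 1 := by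
  simp [P, Finset.sum_range_succ']

theorem P_zero_left (x : ℝ) : P 0 x = 1 := by
  simp [P]

theorem P_succ (m : ℕ) (x : ℝ) :
    P (m + 1) x = P m x + (-1 : ℝ) ^ (m + 1) * x ^ (m + 1) / (m + 1).factorial := by
  rw [P, Finset.sum_range_succ, P]

theorem hasDerivAt_P_succ (m : ℕ) (x : ℝ) : HasDerivAt (P (m + 1)) (-P m x) x := by
  induction m with
  | zero =>
    have h : P (0 + 1) = fun y => 1 - y := by
      funext y
      rw [P_succ, P_zero_left]
      simp [sub_eq_add_neg]
    rw [h, P_zero_left]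
    exact (hasDerivAt_id x).const_sub 1
  | succ m ih =>
    have h : P (m + 1 + 1) = fun y => P (m + 1) y +
        (-1 : ℝ) ^ (m + 1 + 1) * y ^ (m + 1 + 1) / (m + 1 + 1).factorial :=
      funext (P_succ (m + 1))
    rw [h]
    refine (ih.add (((hasDerivAt_pow (m + 1 + 1) x).const_mul
      ((-1 : ℝ) ^ (m + 1 + 1))).div_const ((m + 1 + 1).factorial : ℝ))).congr_deriv ?_
    rw [P_succ, Nat.factorial_succ (m + 1)]
    have : ((m + 1).factorial : ℝ) ≠ 0 := by positivity
    have : ((m : ℝ) + 1 + 1) ≠ 0 := by positivity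
    push_cast
    field_simp
    ring

/-- The remainder `e^{-x} - P_m(x)`, with the sign that makes it positive for `x > 0`. -/
noncomputable def signedRemainder (m : ℕ) (x : ℝ) : ℝ :=
  (-1 : ℝ) ^ (m + 1) * (Real.exp (-x) - P m x)

theorem signedRemainder_zero_right (m : ℕ) : signedRemainder m 0 = 0 := by
  simp [signedRemainder, P_zero_right]

theorem hasDerivAt_signedRemainder_succ (m : ℕ) (x : ℝ) :
    HasDerivAt (signedRemainder (m + 1)) (signedRemainder m x) x := by
  refine ((((hasDerivAt_neg x).exp).sub (hasDerivAt_P_succ m x)).const_mul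
    ((-1 : ℝ) ^ (m + 1 + 1))).congr_deriv ?_
  rw [signedRemainder]
  ring

theorem signedRemainder_pos (m : ℕ) {x : ℝ} (hx : 0 < x) : 0 < signedRemainder m x := by
  induction m generalizing x with
  | zero =>
    have : Real.exp (-x) < 1 := Real.exp_lt_one_iff.mpr (neg_lt_zero.mpr hx)
    rw [signedRemainder, P_zero_left, zero_add, pow_one]
    linarith
  | succ m ih =>
    exact pos_of_hasDerivAt_pos (signedRemainder_zero_right _)
      (hasDerivAt_signedRemainder_succ m) (fun _ hy => ih hy) hx

theorem signedRemainder_succ_lt (m : ℕ) {x : ℝ} (hx : 0 < x) :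
    signedRemainder (m + 2) x < x * signedRemainder (m + 1) x := by
  refine sub_pos.mp (pos_of_hasDerivAt_pos
    (f := fun y => y * signedRemainder (m + 1) y - signedRemainder (m + 2) y)
    (f' := fun y => y * signedRemainder m y) ?_ (fun y => ?_)
    (fun y hy => mul_pos hy (signedRemainder_pos m hy)) hx)
  · simp [signedRemainder_zero_right]
  · refine (((hasDerivAt_id y).mul (hasDerivAt_signedRemainder_succ m y)).sub
      (hasDerivAt_signedRemainder_succ (m + 1) y)).congr_deriv ?_
    simp

/-- For every integer `n ≥ 1` and every `φ > 0`,
`(−1)^(n+1)·((φ+1)e^{−φ} − P_{n+1}(φ) − φ·P_n(φ)) > 0`; in particular, for odd `n`,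
`P_{n+1}(φ) + φ·P_n(φ) < (φ+1)e^{−φ}`. -/
theorem taylor_shear_ineq (n : ℕ) (hn : 1 ≤ n) (φ : ℝ) (hφ : 0 < φ) :
    0 < (-1 : ℝ) ^ (n + 1) * ((φ + 1) * Real.exp (-φ) - P (n + 1) φ - φ * P n φ) ∧
    (Odd n → P (n + 1) φ + φ * P n φ < (φ + 1) * Real.exp (-φ)) := by
  have key : 0 < (-1 : ℝ) ^ (n + 1) *
      ((φ + 1) * Real.exp (-φ) - P (n + 1) φ - φ * P n φ) := by
    obtain ⟨m, rfl⟩ := Nat.exists_eq_add_of_le' hn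
    have h := sub_pos.mpr (signedRemainder_succ_lt m hφ)
    simp only [signedRemainder] at h
    convert h using 1
    ring
  refine ⟨key, fun hodd => ?_⟩
  rw [hodd.add_one.neg_one_pow] at key
  linarith
end

section
/- Let n ≥ 1 be an integer and let φ : (q_a, q_b) → (0,∞) be a differentiable function satisfying the ODE φ'(q) = F_n(φ(q)) for all q in (q_a, q_b). Then both φ and its derivative φ' are strictly increasing on (q_a, q_b). -/
open MeasureTheory Filter Set

/-- `Fn n φ = (2·(−1)^(n+1)·(n+1)!/φ)·(∑_{k=0}^{n+1} (−1)^k φ^k/k! − e^{−φ})`. -/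
noncomputable def Fn (n : ℕ) (φ : ℝ) : ℝ :=
  2 * (-1 : ℝ) ^ (n + 1) * (Nat.factorial (n + 1)) / φ *
    ((∑ k ∈ Finset.range (n + 2), (-1 : ℝ) ^ k * φ ^ k / (Nat.factorial k)) - Real.exp (-φ))

/-- The remainder `(-1)^m (∑_{k ≤ m} (-x)^k / k! - e^{-x})` of the Taylor series of `e^{-x}`. -/
noncomputable def expNegRemainder (m : ℕ) (x : ℝ) : ℝ :=
  (-1 : ℝ) ^ m *
    ((∑ k ∈ Finset.range (m + 1), (-1 : ℝ) ^ k * x ^ k / (Nat.factorial k)) - Real.exp (-x))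

lemma expNegRemainder_zero_right (m : ℕ) : expNegRemainder m 0 = 0 := by
  simp [expNegRemainder, Finset.sum_range_succ']

lemma hasDerivAt_sum_neg_pow_div_factorial (m : ℕ) (x : ℝ) :
    HasDerivAt (fun x : ℝ => ∑ k ∈ Finset.range (m + 1), (-1 : ℝ) ^ k * x ^ k / (Nat.factorial k))
      (-∑ k ∈ Finset.range m, (-1 : ℝ) ^ k * x ^ k / (Nat.factorial k)) x := by
  induction m with
  | zero => simpa using hasDerivAt_const x (1 : ℝ)
  | succ m ih =>
    have h := ih.fun_add (((hasDerivAt_pow (m + 1) x).const_mul ((-1 : ℝ) ^ (m + 1))).div_const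
      (Nat.factorial (m + 1) : ℝ))
    simp only [← Finset.sum_range_succ (fun k => (-1 : ℝ) ^ k * _ ^ k / (Nat.factorial k))] at h
    refine h.congr_deriv ?_
    rw [Finset.sum_range_succ, Nat.factorial_succ]
    push_cast
    field_simp
    ring

lemma hasDerivAt_expNegRemainder (m : ℕ) (x : ℝ) :
    HasDerivAt (expNegRemainder (m + 1)) (expNegRemainder m x) x := by
  have h := ((hasDerivAt_sum_neg_pow_div_factorial (m + 1) x).sub
    (hasDerivAt_neg x).exp).const_mul ((-1 : ℝ) ^ (m + 1))
  refine h.congr_deriv ?_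
  rw [expNegRemainder]
  ring

lemma strictMonoOn_expNegRemainder (m : ℕ) : StrictMonoOn (expNegRemainder m) (Set.Ici 0) := by
  induction m with
  | zero =>
    intro x _ y _ hxy
    simpa [expNegRemainder] using hxy
  | succ m ih =>
    refine strictMonoOn_of_deriv_pos (convex_Ici 0)
      (fun x _ => (hasDerivAt_expNegRemainder m x).continuousAt.continuousWithinAt) ?_
    intro x hx
    rw [interior_Ici, Set.mem_Ioi] at hx
    rw [(hasDerivAt_expNegRemainder m x).deriv, ← expNegRemainder_zero_right m]
    exact ih Set.self_mem_Ici hx.le hx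

lemma expNegRemainder_pos (m : ℕ) {x : ℝ} (hx : 0 < x) : 0 < expNegRemainder m x := by
  rw [← expNegRemainder_zero_right m]
  exact strictMonoOn_expNegRemainder m Set.self_mem_Ici hx.le hx

lemma strictConvexOn_expNegRemainder (m : ℕ) :
    StrictConvexOn ℝ (Set.Ici 0) (expNegRemainder (m + 1)) := by
  refine StrictMonoOn.strictConvexOn_of_deriv (convex_Ici 0)
    (fun x _ => (hasDerivAt_expNegRemainder m x).continuousAt.continuousWithinAt) ?_
  rw [funext fun x => (hasDerivAt_expNegRemainder m x).deriv]
  exact (strictMonoOn_expNegRemainder m).mono interior_subset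

lemma Fn_eq_expNegRemainder_div (n : ℕ) (x : ℝ) :
    Fn n x = 2 * (Nat.factorial (n + 1)) * (expNegRemainder (n + 1) x / x) := by
  rw [Fn, expNegRemainder]
  ring

lemma Fn_pos (n : ℕ) {x : ℝ} (hx : 0 < x) : 0 < Fn n x := by
  rw [Fn_eq_expNegRemainder_div]
  have := expNegRemainder_pos (n + 1) hx
  positivity

lemma strictMonoOn_Fn (n : ℕ) : StrictMonoOn (Fn n) (Set.Ioi 0) := by
  intro x hx y hy hxy
  rw [Set.mem_Ioi] at hx hy
  have h := (strictConvexOn_expNegRemainder n).secant_strict_mono (a := 0) Set.self_mem_Ici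
    hx.le hy.le hx.ne' hy.ne' hxy
  simp only [expNegRemainder_zero_right, sub_zero] at h
  rw [Fn_eq_expNegRemainder_div, Fn_eq_expNegRemainder_div]
  gcongr

/-- If `φ : (q_a, q_b) → (0,∞)` is differentiable and satisfies `φ' = Fn n ∘ φ`, then both
`φ` and its derivative `φ'` are strictly increasing on `(q_a, q_b)`. -/
theorem sol_strictMono (n : ℕ) (hn : 1 ≤ n) (qa qb : ℝ) (f : ℝ → ℝ)
    (hpos : ∀ q ∈ Set.Ioo qa qb, 0 < f q)
    (hode : ∀ q ∈ Set.Ioo qa qb, HasDerivAt f (Fn n (f q)) q) :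
    StrictMonoOn f (Set.Ioo qa qb) ∧ StrictMonoOn (deriv f) (Set.Ioo qa qb) := by
  have hmono : StrictMonoOn f (Set.Ioo qa qb) := by
    refine strictMonoOn_of_deriv_pos (convex_Ioo qa qb)
      (fun q hq => (hode q hq).continuousAt.continuousWithinAt) fun q hq => ?_
    have hq' := interior_subset hq
    rw [(hode q hq').deriv]
    exact Fn_pos n (hpos q hq')
  refine ⟨hmono, fun x hx y hy hxy => ?_⟩
  rw [(hode x hx).deriv, (hode y hy).deriv]
  exact strictMonoOn_Fn n (hpos x hx) (hpos y hy) (hmono hx hy hxy)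
end

section
/- For every integer n ≥ 1 and every real φ > 0, 2(φ − 1)φ^n < (φ + n)·F_n(φ) < 2φ^{n+1}. (These two inequalities express that the Ricci curvature of the Heisenberg Kähler–Ricci soliton satisfies −g < Ric < 0 on the (k,t)-plane component.) -/
open MeasureTheory Filter Set

/-- The alternating exponential sum times `exp` has a monomial-times-`exp` derivative. -/
theorem hasDerivAt_exp_mul_alternating_sum (N : ℕ) (x : ℝ) :
    HasDerivAt (fun y : ℝ => Real.exp y *
      ∑ k ∈ Finset.range (N + 1), (-1 : ℝ) ^ k * y ^ k / (Nat.factorial k))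
      (Real.exp x * ((-1 : ℝ) ^ N * x ^ N / (Nat.factorial N))) x := by
  induction N with
  | zero => simpa using Real.hasDerivAt_exp x
  | succ N ih =>
    have h := ih.add ((Real.hasDerivAt_exp x).mul
      (((hasDerivAt_pow (N + 1) x).const_mul ((-1 : ℝ) ^ (N + 1))).div_const
        (Nat.factorial (N + 1) : ℝ)))
    refine (h.congr_deriv ?_).congr_of_eventuallyEq (Eventually.of_forall fun y => ?_)
    · have hN : (Nat.factorial N : ℝ) ≠ 0 := by positivity
      have hN' : (N : ℝ) + 1 ≠ 0 := by positivity
      simp only [Nat.factorial_succ, Nat.add_sub_cancel]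
      push_cast
      field_simp
      ring
    · simp only [Pi.add_apply, Pi.mul_apply]
      rw [Finset.sum_range_succ _ (N + 1)]
      ring

/-- The function `e^φ · φ · Fn n φ / 2`, written without division by `φ`. -/
noncomputable def expRemainder (n : ℕ) (x : ℝ) : ℝ :=
  (-1 : ℝ) ^ (n + 1) * (Nat.factorial (n + 1)) *
    (Real.exp x * (∑ k ∈ Finset.range (n + 2), (-1 : ℝ) ^ k * x ^ k / (Nat.factorial k)) - 1)

theorem expRemainder_zero (n : ℕ) : expRemainder n 0 = 0 := by
  simp [expRemainder, Finset.sum_range_succ']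

theorem hasDerivAt_expRemainder (n : ℕ) (x : ℝ) :
    HasDerivAt (expRemainder n) (Real.exp x * x ^ (n + 1)) x := by
  refine (((hasDerivAt_exp_mul_alternating_sum (n + 1) x).sub_const 1).const_mul
    ((-1 : ℝ) ^ (n + 1) * (Nat.factorial (n + 1)))).congr_deriv ?_
  have hN : (Nat.factorial (n + 1) : ℝ) ≠ 0 := by positivity
  have h1 : (-1 : ℝ) ^ (n + 1) * (-1) ^ (n + 1) = 1 := by
    rw [← mul_pow]; norm_num
  field_simp
  linear_combination (x ^ (n + 1)) * h1

theorem Fn_eq_expRemainder (n : ℕ) {x : ℝ} (hx : x ≠ 0) :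
    Fn n x = 2 * expRemainder n x / (x * Real.exp x) := by
  have he := Real.exp_ne_zero x
  simp only [Fn, expRemainder, Real.exp_neg]
  field_simp

theorem lt_of_hasDerivAt_lt {f g f' g' : ℝ → ℝ} (h0 : f 0 = g 0)
    (hf : ∀ x, 0 ≤ x → HasDerivAt f (f' x) x) (hg : ∀ x, 0 ≤ x → HasDerivAt g (g' x) x)
    (h : ∀ x, 0 < x → f' x < g' x) {x : ℝ} (hx : 0 < x) : f x < g x := by
  have hd : ∀ y, 0 ≤ y → HasDerivAt (g - f) (g' y - f' y) y :=
    fun y hy => (hg y hy).sub (hf y hy)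
  have hmono : StrictMonoOn (g - f) (Ici 0) := by
    refine strictMonoOn_of_deriv_pos (convex_Ici 0)
      (fun y hy => (hd y hy).continuousAt.continuousWithinAt) fun y hy => ?_
    rw [interior_Ici, mem_Ioi] at hy
    rw [(hd y hy.le).deriv]
    exact sub_pos.2 (h y hy)
  have := hmono (mem_Ici.2 le_rfl) (mem_Ici.2 hx.le) hx
  simp only [Pi.sub_apply, h0, sub_self] at this
  exact sub_pos.1 this

theorem expRemainder_lt (n : ℕ) (hn : 1 ≤ n) {x : ℝ} (hx : 0 < x) :
    expRemainder n x < Real.exp x * x ^ (n + 2) / (x + n) := by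
  refine lt_of_hasDerivAt_lt (f := expRemainder n)
    (g := fun y => Real.exp y * y ^ (n + 2) / (y + n)) (by simp [expRemainder_zero])
    (fun y _ => hasDerivAt_expRemainder n y)
    (fun y hy => ((Real.hasDerivAt_exp y).mul (hasDerivAt_pow (n + 2) y)).div
      ((hasDerivAt_id y).add_const (n : ℝ)) (by positivity)) ?_ hx
  intro y hy
  simp only [Pi.mul_apply]
  rw [lt_div_iff₀ (by positivity), ← sub_pos]
  have : 0 < Real.exp y * y ^ (n + 1) * (y + 2 * n) := by positivity
  refine this.trans_eq ?_
  rw [show n + 2 - 1 = n + 1 by omega]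
  push_cast
  ring

theorem lt_expRemainder (n : ℕ) (hn : 1 ≤ n) {x : ℝ} (hx : 0 < x) :
    Real.exp x * ((x - 1) * x ^ (n + 1)) / (x + n) < expRemainder n x := by
  refine lt_of_hasDerivAt_lt (g := expRemainder n)
    (f := fun y => Real.exp y * ((y - 1) * y ^ (n + 1)) / (y + n)) (by simp [expRemainder_zero])
    (fun y hy => ((Real.hasDerivAt_exp y).mul
      (((hasDerivAt_id y).sub_const 1).mul (hasDerivAt_pow (n + 1) y))).div
      ((hasDerivAt_id y).add_const (n : ℝ)) (by positivity))
    (fun y _ => hasDerivAt_expRemainder n y) ?_ hx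
  intro y hy
  simp only [Pi.mul_apply, id]
  rw [div_lt_iff₀ (by positivity), ← sub_pos]
  have : 0 < Real.exp y * y ^ n * ((n + 1) * n) := by positivity
  refine this.trans_eq ?_
  rw [show n + 1 - 1 = n by omega]
  push_cast
  ring

/-- For every integer `n ≥ 1` and every real `φ > 0`,
`2(φ−1)φ^n < (φ+n)·Fn n φ < 2φ^{n+1}` (i.e. `−g < Ric < 0` on the `(k,t)`-plane component). -/
theorem ricci_bounds (n : ℕ) (hn : 1 ≤ n) (φ : ℝ) (hφ : 0 < φ) :
    2 * (φ - 1) * φ ^ n < (φ + (n : ℝ)) * Fn n φ ∧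
    (φ + (n : ℝ)) * Fn n φ < 2 * φ ^ (n + 1) := by
  have hs : 0 < φ + (n : ℝ) := by positivity
  have he := Real.exp_pos φ
  have hl := lt_expRemainder n hn hφ
  have hu := expRemainder_lt n hn hφ
  rw [div_lt_iff₀ hs] at hl
  rw [lt_div_iff₀ hs] at hu
  rw [Fn_eq_expRemainder n hφ.ne', mul_div_assoc', lt_div_iff₀ (by positivity),
    div_lt_iff₀ (by positivity)]
  constructor
  · linear_combination 2 * hl
  · linear_combination 2 * hu
end

section
/- For every integer n ≥ 1 and every real φ > 0, (n + 1 + φ)·F_n(φ) < 2φ^{n+1}. (Equivalently, the frame sectional curvature Sec(k,x) = ((n+1+φ)F_n(φ)/φ^{n+1} − 2)/4 of the Heisenberg Kähler–Ricci soliton is strictly negative.) -/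
open MeasureTheory Filter Set

/-- The Taylor remainder of `e^{-x}` of order `m`, scaled by `(-1)^m m! e^x`; it equals
`∫ s in 0..x, e^s s^m`. -/
noncomputable def scaledExpRemainder (m : ℕ) (x : ℝ) : ℝ :=
  (-1 : ℝ) ^ m * (Nat.factorial m) *
    (Real.exp x * (∑ k ∈ Finset.range (m + 1), (-1 : ℝ) ^ k * x ^ k / (Nat.factorial k)) - 1)

theorem scaledExpRemainder_succ (m : ℕ) (x : ℝ) :
    scaledExpRemainder (m + 1) x =
      Real.exp x * x ^ (m + 1) - (m + 1) * scaledExpRemainder m x := by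
  have hsq : ((-1 : ℝ) ^ m) ^ 2 = 1 := by rw [← pow_mul, mul_comm, pow_mul]; norm_num
  have hf : (Nat.factorial m : ℝ) ≠ 0 := by exact_mod_cast Nat.factorial_ne_zero m
  unfold scaledExpRemainder
  rw [Finset.sum_range_succ _ (m + 1), Nat.factorial_succ]
  generalize (∑ k ∈ Finset.range (m + 1), (-1 : ℝ) ^ k * x ^ k / (Nat.factorial k)) = S
  push_cast
  rw [pow_succ (-1 : ℝ) m]
  field_simp
  linear_combination Real.exp x * x ^ (m + 1) * hsq

theorem scaledExpRemainder_zero_right (m : ℕ) : scaledExpRemainder m 0 = 0 := by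
  simp [scaledExpRemainder, Finset.sum_range_succ']

theorem hasDerivAt_scaledExpRemainder (m : ℕ) (x : ℝ) :
    HasDerivAt (scaledExpRemainder m) (Real.exp x * x ^ m) x := by
  induction m with
  | zero =>
    have h : scaledExpRemainder 0 = fun x => Real.exp x - 1 := by
      funext y; simp [scaledExpRemainder]
    simpa [h] using (Real.hasDerivAt_exp x).sub_const 1
  | succ m ih =>
    rw [funext (scaledExpRemainder_succ m)]
    refine (((Real.hasDerivAt_exp x).mul (hasDerivAt_pow (m + 1) x)).sub
      (ih.const_mul ((m : ℝ) + 1))).congr_deriv ?_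
    push_cast
    ring

theorem scaledExpRemainder_lt {m : ℕ} (hm : 0 < m) {x : ℝ} (hx : 0 < x) :
    scaledExpRemainder m x < Real.exp x * x ^ (m + 1) / (m + x) := by
  have hm' : (0 : ℝ) < m := by exact_mod_cast hm
  have hderiv (y : ℝ) (hy : 0 ≤ y) :
      HasDerivAt (fun y => Real.exp y * y ^ (m + 1) / (m + y) - scaledExpRemainder m y)
        (Real.exp y * y ^ m * m / (m + y) ^ 2) y := by
    have hne : (m : ℝ) + y ≠ 0 := by positivity
    refine ((((Real.hasDerivAt_exp y).mul (hasDerivAt_pow (m + 1) y)).div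
      ((hasDerivAt_id y).const_add (m : ℝ)) hne).sub
      (hasDerivAt_scaledExpRemainder m y)).congr_deriv ?_
    push_cast
    simp only [id, Pi.mul_apply]
    field_simp
    ring
  have hmono : StrictMonoOn
      (fun y => Real.exp y * y ^ (m + 1) / (m + y) - scaledExpRemainder m y) (Ici 0) := by
    refine strictMonoOn_of_deriv_pos (convex_Ici 0)
      (fun y hy => (hderiv y hy).continuousAt.continuousWithinAt) fun y hy => ?_
    rw [interior_Ici, mem_Ioi] at hy
    rw [(hderiv y hy.le).deriv]
    positivity
  have h := hmono self_mem_Ici (mem_Ici.2 hx.le) hx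
  simpa [scaledExpRemainder_zero_right] using h

theorem Fn_eq_scaledExpRemainder (n : ℕ) (φ : ℝ) :
    Fn n φ = 2 * scaledExpRemainder (n + 1) φ / (φ * Real.exp φ) := by
  unfold Fn scaledExpRemainder
  rw [Real.exp_neg]
  have := Real.exp_ne_zero φ
  field_simp

/-- For every integer `n ≥ 1` and every real `φ > 0`, `(n+1+φ)·Fn n φ < 2φ^{n+1}`
(negativity of the frame sectional curvature `Sec(k,x)`). -/
theorem sec_kx_neg (n : ℕ) (hn : 1 ≤ n) (φ : ℝ) (hφ : 0 < φ) :
    ((n : ℝ) + 1 + φ) * Fn n φ < 2 * φ ^ (n + 1) := by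
  have h := scaledExpRemainder_lt (Nat.add_one_pos n) hφ
  push_cast at h
  rw [lt_div_iff₀ (by positivity)] at h
  rw [Fn_eq_scaledExpRemainder, ← mul_div_assoc, div_lt_iff₀ (by positivity)]
  linear_combination 2 * h
end

section
/- For every integer n ≥ 1: F_n(φ)/φ^n → 2 as φ → ∞, and F_n(φ)/φ^{n+1} → 2/(n+2) as φ → 0⁺. (These limits give the asymptotics of the Heisenberg Kähler–Ricci soliton: a conical end at φ → ∞ and an end asymptotic to a metric of constant holomorphic sectional curvature −2/(n+2) at φ → 0.) -/
open MeasureTheory Filter Set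

open Topology in
/-- The leading term of the Taylor remainder of the exponential at `0`. -/
theorem tendsto_exp_sub_sum_range_div_pow (m : ℕ) :
    Tendsto (fun x : ℝ => (Real.exp x - ∑ k ∈ Finset.range m, x ^ k / (Nat.factorial k)) / x ^ m)
      (𝓝[≠] 0) (𝓝 (1 / (Nat.factorial m))) := by
  have h := ((Real.exp_sub_sum_range_succ_isLittleO_pow m).tendsto_div_nhds_zero.mono_left
    (nhdsWithin_le_nhds (s := {(0 : ℝ)}ᶜ))).add_const (1 / (Nat.factorial m : ℝ))
  rw [zero_add] at h
  refine h.congr' ?_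
  filter_upwards [self_mem_nhdsWithin] with x hx
  have hx' : x ≠ 0 := hx
  rw [Finset.sum_range_succ]
  field_simp
  ring

open Topology in
/-- A polynomial `∑ k ≤ m, a k * x ^ k` divided by `x ^ m` tends to `a m` at infinity. -/
theorem tendsto_sum_range_succ_mul_pow_div_pow_atTop (a : ℕ → ℝ) (m : ℕ) :
    Tendsto (fun x : ℝ => (∑ k ∈ Finset.range (m + 1), a k * x ^ k) / x ^ m) atTop (𝓝 (a m)) := by
  have hlow : Tendsto (fun x : ℝ => ∑ k ∈ Finset.range m, a k * (x ^ k / x ^ m)) atTop (𝓝 0) := by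
    have h := tendsto_finsetSum (Finset.range m) fun k hk =>
      (tendsto_pow_div_pow_atTop_zero (𝕜 := ℝ) (Finset.mem_range.mp hk)).const_mul (a k)
    simpa using h
  have h := hlow.add_const (a m)
  rw [zero_add] at h
  refine h.congr' ?_
  filter_upwards [eventually_ne_atTop 0] with x hx
  rw [Finset.sum_range_succ, add_div, Finset.sum_div]
  simp only [mul_div_assoc, div_self (pow_ne_zero m hx), mul_one]

/-- For every integer `n ≥ 1`: `Fn n φ/φ^n → 2` as `φ → ∞`, and
`Fn n φ/φ^{n+1} → 2/(n+2)` as `φ → 0⁺`. -/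
theorem Fn_asymptotics (n : ℕ) (hn : 1 ≤ n) :
    Tendsto (fun φ : ℝ => Fn n φ / φ ^ n) atTop (nhds 2) ∧
    Tendsto (fun φ : ℝ => Fn n φ / φ ^ (n + 1)) (nhdsWithin 0 (Set.Ioi 0))
      (nhds (2 / ((n : ℝ) + 2))) := by
  have hfac : (Nat.factorial (n + 1) : ℝ) ≠ 0 := by positivity
  have hsign : ((-1 : ℝ) ^ (n + 1)) * (-1) ^ (n + 1) = 1 := by
    rw [← mul_pow]; norm_num
  constructor
  · have hpoly := tendsto_sum_range_succ_mul_pow_div_pow_atTop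
      (fun k => (-1 : ℝ) ^ k / (Nat.factorial k)) (n + 1)
    have hexp : Tendsto (fun x : ℝ => Real.exp (-x) / x ^ (n + 1)) atTop (nhds 0) :=
      (Real.tendsto_exp_neg_atTop_nhds_zero).div_atTop (tendsto_pow_atTop n.succ_ne_zero)
    have h := (hpoly.sub hexp).const_mul (2 * (-1 : ℝ) ^ (n + 1) * (Nat.factorial (n + 1)))
    have hlim : 2 * (-1 : ℝ) ^ (n + 1) * (Nat.factorial (n + 1)) *
        ((-1 : ℝ) ^ (n + 1) / (Nat.factorial (n + 1)) - 0) = 2 := by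
      field_simp
      linear_combination hsign
    rw [hlim] at h
    refine h.congr fun x => ?_
    simp only [Fn, div_mul_eq_mul_div]
    rw [← sub_div, div_div, ← pow_succ', mul_div_assoc]
  · have hneg : Tendsto (fun x : ℝ => -x) (nhdsWithin 0 (Set.Ioi 0)) (nhdsWithin 0 {0}ᶜ) := by
      refine tendsto_nhdsWithin_iff.mpr ⟨?_, ?_⟩
      · simpa using (continuous_neg.tendsto (0 : ℝ)).mono_left nhdsWithin_le_nhds
      · filter_upwards [self_mem_nhdsWithin] with x hx
        exact neg_ne_zero.mpr (ne_of_gt hx)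
    have h := ((tendsto_exp_sub_sum_range_div_pow (n + 2)).comp hneg).const_mul
      (2 * (Nat.factorial (n + 1) : ℝ))
    have hlim : 2 * (Nat.factorial (n + 1) : ℝ) * (1 / (Nat.factorial (n + 2))) =
        2 / ((n : ℝ) + 2) := by
      rw [Nat.factorial_succ (n + 1)]
      push_cast
      field_simp
      ring
    rw [hlim] at h
    refine h.congr' ?_
    filter_upwards [self_mem_nhdsWithin] with x hx
    have hx' : x ≠ 0 := ne_of_gt hx
    have hsum : ∑ k ∈ Finset.range (n + 2), (-x) ^ k / (Nat.factorial k : ℝ) =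
        ∑ k ∈ Finset.range (n + 2), (-1 : ℝ) ^ k * x ^ k / (Nat.factorial k) :=
      Finset.sum_congr rfl fun k _ => by rw [neg_pow]
    simp only [Function.comp_apply, Fn, hsum]
    rw [neg_pow x (n + 2), pow_succ (-1 : ℝ) (n + 1)]
    field_simp
    linear_combination x ^ (n + 2) * (Real.exp (-x) -
      ∑ k ∈ Finset.range (n + 2), (-1 : ℝ) ^ k * x ^ k / (Nat.factorial k)) * hsign
end

section
/- Let ε : [0,∞) → ℝ be a C¹ function with ε(0) = 0, ε(β) ≥ 0 for all β ≥ 0, and ε'(β) > −2β for all β > 0. Let a, b, c : (ξ, t₀] → (0,∞) be differentiable functions satisfying 2a'/a = −a² + c², 2b'/b = a² + c², 2c'/c = a² − c² + 2a²b² + 2ε(b)a². Then: (i) if c(t₀)² − a(t₀)² < 0, then c(t)² − a(t)² < 0 for all t ∈ (ξ, t₀]; and (ii) if c(t₀)² − a(t₀)² > 2a(t₀)²(b(t₀)² + ε(b(t₀))), then c(t)² − a(t)² > 2a(t)²(b(t)² + ε(b(t))) for all t ∈ (ξ, t₀]. (These backward invariance properties of the regions c² < a² and c² − a² > 2a²(b²+ε(b))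 are the key steps in classifying solutions of the E(2) skew-soliton system.) -/
open MeasureTheory Filter Set

/-- A function on `(ξ, t₀]` whose derivative is positive at each of its zeros and which is
negative at `t₀` is negative everywhere. -/
lemma neg_on_Ioc_of_deriv_pos_of_eq_zero {ξ t₀ : ℝ} {f f' : ℝ → ℝ}
    (hf : ∀ t ∈ Set.Ioc ξ t₀, HasDerivWithinAt f (f' t) (Set.Ioc ξ t₀) t)
    (hpos : ∀ t ∈ Set.Ioc ξ t₀, f t = 0 → 0 < f' t) (h₀ : f t₀ < 0) :
    ∀ t ∈ Set.Ioc ξ t₀, f t < 0 := by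
  intro t ht
  by_contra! hft
  have hsub : Set.Icc t t₀ ⊆ Set.Ioc ξ t₀ := fun x hx => ⟨ht.1.trans_le hx.1, hx.2⟩
  have key := image_le_of_deriv_right_lt_deriv_boundary' (f := fun x => -f x)
    (f' := fun x => -f' x) (B := fun _ => 0) (B' := fun _ => 0) (a := t) (b := t₀)
    (fun x hx => ((hf x (hsub hx)).continuousWithinAt.mono hsub).neg)
    (fun x hx => by
      have hx' : x ∈ Set.Ioc ξ t₀ := hsub ⟨hx.1, hx.2.le⟩
      have h : HasDerivWithinAt f (f' x) (Set.Icc x t₀) x :=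
        (hf x hx').mono fun y hy => ⟨hx'.1.trans_le hy.1, hy.2⟩
      exact (h.mono_of_mem_nhdsWithin (Icc_mem_nhdsGE hx.2)).neg)
    (by simpa using hft) continuousOn_const
    (fun x _ => hasDerivWithinAt_const x _ 0)
    (fun x hx h => by
      have := hpos x (hsub ⟨hx.1, hx.2.le⟩) (by simpa using h)
      simpa using this)
    (Set.right_mem_Icc.2 ht.2)
  simp only [Left.neg_nonpos_iff] at key
  linarith

/-- Let `ε` be `C¹` on `[0,∞)` with `ε(0) = 0`, `ε ≥ 0` on `[0,∞)` and `ε'(β) > −2β` for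
`β > 0`.  Let `a, b, c : (ξ, t₀] → (0,∞)` satisfy the E(2) skew-soliton system
`2a'/a = −a² + c²`, `2b'/b = a² + c²`, `2c'/c = a² − c² + 2a²b² + 2ε(b)a²`.  Then:
(i) if `c(t₀)² − a(t₀)² < 0` then `c(t)² − a(t)² < 0` on all of `(ξ, t₀]`; and
(ii) if `c(t₀)² − a(t₀)² > 2a(t₀)²(b(t₀)² + ε(b(t₀)))` then
`c(t)² − a(t)² > 2a(t)²(b(t)² + ε(b(t)))` on all of `(ξ, t₀]`. -/
theorem E2_backward_invariance (ε : ℝ → ℝ)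
    (hε_smooth : ContDiffOn ℝ 1 ε (Set.Ici 0))
    (hε0 : ε 0 = 0)
    (hε_nonneg : ∀ β : ℝ, 0 ≤ β → 0 ≤ ε β)
    (hε_deriv : ∀ β : ℝ, 0 < β → -2 * β < derivWithin ε (Set.Ici 0) β)
    (ξ t₀ : ℝ) (a b c : ℝ → ℝ)
    (ha : ∀ t ∈ Set.Ioc ξ t₀, 0 < a t)
    (hb : ∀ t ∈ Set.Ioc ξ t₀, 0 < b t)
    (hc : ∀ t ∈ Set.Ioc ξ t₀, 0 < c t)
    (hda : ∀ t ∈ Set.Ioc ξ t₀,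
      HasDerivWithinAt a (a t * (-(a t) ^ 2 + c t ^ 2) / 2) (Set.Ioc ξ t₀) t)
    (hdb : ∀ t ∈ Set.Ioc ξ t₀,
      HasDerivWithinAt b (b t * (a t ^ 2 + c t ^ 2) / 2) (Set.Ioc ξ t₀) t)
    (hdc : ∀ t ∈ Set.Ioc ξ t₀,
      HasDerivWithinAt c
        (c t * (a t ^ 2 - c t ^ 2 + 2 * a t ^ 2 * b t ^ 2 + 2 * ε (b t) * a t ^ 2) / 2)
        (Set.Ioc ξ t₀) t) :
    (c t₀ ^ 2 - a t₀ ^ 2 < 0 →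
      ∀ t ∈ Set.Ioc ξ t₀, c t ^ 2 - a t ^ 2 < 0) ∧
    (c t₀ ^ 2 - a t₀ ^ 2 > 2 * a t₀ ^ 2 * (b t₀ ^ 2 + ε (b t₀)) →
      ∀ t ∈ Set.Ioc ξ t₀, c t ^ 2 - a t ^ 2 > 2 * a t ^ 2 * (b t ^ 2 + ε (b t))) := by
  have hK : ∀ t ∈ Set.Ioc ξ t₀, 0 < b t ^ 2 + ε (b t) := fun t ht =>
    add_pos_of_pos_of_nonneg (pow_pos (hb t ht) 2) (hε_nonneg _ (hb t ht).le)
  constructor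
  · intro h₀
    refine neg_on_Ioc_of_deriv_pos_of_eq_zero
      (fun t ht => ((hdc t ht).pow 2).sub ((hda t ht).pow 2)) (fun t ht h => ?_) h₀
    have hca : c t ^ 2 = a t ^ 2 := sub_eq_zero.1 h
    have hpos : 0 < 2 * a t ^ 4 * (b t ^ 2 + ε (b t)) :=
      mul_pos (mul_pos two_pos (pow_pos (ha t ht) 4)) (hK t ht)
    refine hpos.trans_eq ?_
    push_cast
    linear_combination (-2 * a t ^ 2 * (b t ^ 2 + ε (b t)) + c t ^ 2 + a t ^ 2) * hca
  · intro h₀ t ht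
    have hdε : ∀ t ∈ Set.Ioc ξ t₀, HasDerivWithinAt (fun s => ε (b s))
        (derivWithin ε (Set.Ici 0) (b t) * (b t * (a t ^ 2 + c t ^ 2) / 2))
        (Set.Ioc ξ t₀) t := fun t ht =>
      ((hε_smooth.differentiableOn one_ne_zero (b t) (hb t ht).le).hasDerivWithinAt).comp t
        (hdb t ht) fun s hs => (hb s hs).le
    have key := neg_on_Ioc_of_deriv_pos_of_eq_zero
      (f := fun t => 2 * a t ^ 2 * (b t ^ 2 + ε (b t)) - (c t ^ 2 - a t ^ 2))
      (fun t ht => ((((hda t ht).pow 2).const_mul 2).mul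
        (((hdb t ht).pow 2).add (hdε t ht))).sub
          (((hdc t ht).pow 2).sub ((hda t ht).pow 2))) (fun t ht h => ?_) (by simpa using h₀) t ht
    · simpa using key
    · have hca : c t ^ 2 = a t ^ 2 + 2 * a t ^ 2 * (b t ^ 2 + ε (b t)) := by
        linarith
      have hat := ha t ht
      have hbt := hb t ht
      have hKt := hK t ht
      have hct := hc t ht
      have hd : 0 < 2 * b t + derivWithin ε (Set.Ici 0) (b t) := by
        linarith [hε_deriv (b t) hbt]
      have hpos : 0 < 4 * a t ^ 4 * (b t ^ 2 + ε (b t)) ^ 2 + 2 * a t ^ 4 * (b t ^ 2 + ε (b t))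
          + a t ^ 2 * (2 * b t + derivWithin ε (Set.Ici 0) (b t)) * b t
            * (a t ^ 2 + c t ^ 2) := by
        positivity
      refine hpos.trans_eq ?_
      simp
      linear_combination (-2 * a t ^ 2 * (b t ^ 2 + ε (b t)) - a t ^ 2 - c t ^ 2) * hca
end
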